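/- arXiv:2002.03296 — 2 statements merged into one kernel-verified Lean document; each statement's English description precedes it below -/
import Mathlib

section
/- For all integers n ≥ 1 and 1 ≤ r ≤ n, Γ_B^(n)(2^{n−1}, r) = C(n−1,≤r) / (2·C(n,≤r)); that is, the maximum ball-noise stability of a Boolean function with exactly 2^{n−1} ones equals C(n−1,≤r)/(2·C(n,≤r)), attained by a subcube. -/
open Finset

noncomputable section

/-- The Hamming ball of radius `r` around the all-ones vector in `{-1,1}^n`
(vertices modeled as `Fin n → ℤˣ`, where `ℤˣ = {1, -1}`). -/
def hBall (n r : ℕ) : Finset (Fin n → ℤˣ) :=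
  Finset.univ.filter fun z => hammingDist z 1 ≤ r

/-- The Hamming sphere of radius `r` around the all-ones vector. -/
def hSphere (n r : ℕ) : Finset (Fin n → ℤˣ) :=
  Finset.univ.filter fun z => hammingDist z 1 = r

/-- Ball-noise stability `E[f(X) f(X∘Z)]`, `X` uniform on the cube, `Z` uniform on `B_r`. -/
def BStab (n r : ℕ) (f : (Fin n → ℤˣ) → ℝ) : ℝ :=
  (∑ x : Fin n → ℤˣ, ∑ z ∈ hBall n r, f x * f (x * z)) / (2 ^ n * (hBall n r).card)

/-- Sphere-noise stability `E[f(X) f(X∘Z)]`, `X` uniform on the cube, `Z` uniform on `S_r`. -/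
def SStab (n r : ℕ) (f : (Fin n → ℤˣ) → ℝ) : ℝ :=
  (∑ x : Fin n → ℤˣ, ∑ z ∈ hSphere n r, f x * f (x * z)) / (2 ^ n * (hSphere n r).card)

/-- i.i.d.-noise stability `E[f(X) f(X∘Z)]`, `Z` with i.i.d. coordinates equal to `-1`
with probability `β` and `1` with probability `1-β`. -/
def Stab (n : ℕ) (β : ℝ) (f : (Fin n → ℤˣ) → ℝ) : ℝ :=
  (∑ x : Fin n → ℤˣ, ∑ z : Fin n → ℤˣ,
      (∏ i, if z i = 1 then 1 - β else β) * (f x * f (x * z))) / 2 ^ n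

/-- Indicator function of a set `A` of vertices. -/
def indic (n : ℕ) (A : Finset (Fin n → ℤˣ)) : (Fin n → ℤˣ) → ℝ :=
  fun x => if x ∈ A then 1 else 0

/-- `Γ_B^(n)(M,r)`: maximal ball-noise stability over Boolean functions with exactly `M` ones. -/
def GammaB (n M r : ℕ) : ℝ :=
  sSup {y | ∃ A : Finset (Fin n → ℤˣ), A.card = M ∧ y = BStab n r (indic n A)}

/-- `Γ_S^(n)(M,r)`: maximal sphere-noise stability over Boolean functions with exactly `M` ones. -/
def GammaS (n M r : ℕ) : ℝ :=
  sSup {y | ∃ A : Finset (Fin n → ℤˣ), A.card = M ∧ y = SStab n r (indic n A)}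

/-- `Γ_IID^(n)(M,β)`: maximal i.i.d.-noise stability over Boolean functions with exactly `M` ones. -/
def GammaIID (n M : ℕ) (β : ℝ) : ℝ :=
  sSup {y | ∃ A : Finset (Fin n → ℤˣ), A.card = M ∧ y = Stab n β (indic n A)}

/-- `Γ_IID(α,β) := sup_n Γ_IID^(n)(⌊α·2^n⌋, β)` (equivalently the limit, by monotonicity). -/
def GammaIIDlim (α β : ℝ) : ℝ := ⨆ n : ℕ, GammaIID n ⌊α * 2 ^ n⌋₊ β

/-- `C(n, ≤ r) = Σ_{i=0}^r C(n,i)`. -/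
def ballBinom (n r : ℕ) : ℕ := ∑ i ∈ Finset.range (r + 1), n.choose i

/-- The quadratic form `∑ x, ∑ z, w (d_H(z, 1)) g(x) g(x∘z)` of a radial kernel on the cube. -/
def radialForm {n : ℕ} (w : ℕ → ℝ) (g : (Fin n → ℤˣ) → ℝ) : ℝ :=
  ∑ x, ∑ z, w (hammingDist z 1) * (g x * g (x * z))

/-- Summing over the `(n+1)`-cube is summing over its two opposite facets. -/
lemma sum_cube_succ {M : Type*} [AddCommMonoid M] {n : ℕ} (F : (Fin (n + 1) → ℤˣ) → M) :
    ∑ x, F x = ∑ x : Fin n → ℤˣ, (F (Fin.cons 1 x) + F (Fin.cons (-1) x)) := by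
  rw [← (Fin.consEquiv fun _ : Fin (n + 1) => ℤˣ).sum_comp, Fintype.sum_prod_type, sum_comm]
  refine sum_congr rfl fun x _ => ?_
  have hu : (univ : Finset ℤˣ) = {1, -1} := rfl
  rw [hu, sum_pair (by decide)]
  rfl

lemma hammingDist_cons_one_one {n : ℕ} (z : Fin n → ℤˣ) :
    hammingDist (Fin.cons 1 z : Fin (n + 1) → ℤˣ) 1 = hammingDist z 1 := by
  simp [hammingDist, card_filter, Fin.sum_univ_succ]

lemma hammingDist_cons_neg_one_one {n : ℕ} (z : Fin n → ℤˣ) :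
    hammingDist (Fin.cons (-1) z : Fin (n + 1) → ℤˣ) 1 = hammingDist z 1 + 1 := by
  simp [hammingDist, card_filter, Fin.sum_univ_succ, add_comm]

lemma cons_mul_cons {n : ℕ} (a b : ℤˣ) (x z : Fin n → ℤˣ) :
    (Fin.cons a x * Fin.cons b z : Fin (n + 1) → ℤˣ) = Fin.cons (a * b) (x * z) := by
  ext i
  refine Fin.cases ?_ (fun j => ?_) i <;> simp

lemma radialForm_succ {n : ℕ} (w : ℕ → ℝ) (g : (Fin (n + 1) → ℤˣ) → ℝ) :
    radialForm w g =
      (radialForm (fun k => w k + w (k + 1)) (fun x => g (Fin.cons 1 x) + g (Fin.cons (-1) x)) +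
       radialForm (fun k => w k - w (k + 1))
        (fun x => g (Fin.cons 1 x) - g (Fin.cons (-1) x))) / 2 := by
  simp only [radialForm, sum_cube_succ, cons_mul_cons, hammingDist_cons_one_one,
    hammingDist_cons_neg_one_one, ← sum_add_distrib, sum_div]
  refine sum_congr rfl fun x _ => sum_congr rfl fun z _ => ?_
  simp only [mul_one, one_mul, neg_mul_neg]
  ring

lemma radialForm_eq_sum_mul {n : ℕ} (w : ℕ → ℝ) (g : (Fin n → ℤˣ) → ℝ) :
    radialForm w g = ∑ z, w (hammingDist z 1) * ∑ x, g x * g (x * z) := by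
  rw [radialForm, sum_comm]
  simp only [mul_sum]

lemma radialForm_add {n : ℕ} (w w' : ℕ → ℝ) (g : (Fin n → ℤˣ) → ℝ) :
    radialForm (fun k => w k + w' k) g = radialForm w g + radialForm w' g := by
  simp only [radialForm, add_mul, sum_add_distrib]

lemma sum_cube_mul_right {n : ℕ} (f : (Fin n → ℤˣ) → ℝ) (z : Fin n → ℤˣ) :
    ∑ x, f (x * z) = ∑ x, f x :=
  Equiv.sum_comp (Equiv.mulRight z) f

lemma radialForm_le {n : ℕ} (w : ℕ → ℝ) (hw : ∀ k, 0 ≤ w k) (g : (Fin n → ℤˣ) → ℝ) :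
    radialForm w g ≤ (∑ z : Fin n → ℤˣ, w (hammingDist z 1)) * ∑ x, g x ^ 2 := by
  rw [radialForm_eq_sum_mul, sum_mul]
  refine sum_le_sum fun z _ => ?_
  refine mul_le_mul_of_nonneg_left ?_ (hw _)
  have h := sum_cube_mul_right (fun x => g x ^ 2) z
  have h' : ∑ x, g x * g (x * z) ≤ ∑ x, (g x ^ 2 + g (x * z) ^ 2) / 2 :=
    sum_le_sum fun x _ => by nlinarith [sq_nonneg (g x - g (x * z))]
  rw [← sum_div, sum_add_distrib, h] at h'
  linarith

lemma sum_hammingDist_eq (n r : ℕ) :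
    ∑ z : Fin n → ℤˣ, (if hammingDist z 1 = r then (1 : ℝ) else 0) = n.choose r := by
  induction n generalizing r with
  | zero => cases r <;> simp [hammingDist]
  | succ n ih =>
    simp only [sum_cube_succ, hammingDist_cons_one_one, hammingDist_cons_neg_one_one,
      sum_add_distrib, ih]
    cases r with
    | zero => simp
    | succ r =>
      simp only [add_left_inj, ih]
      rw [Nat.choose_succ_succ]
      push_cast
      ring

lemma sum_hammingDist_le (n r : ℕ) :
    ∑ z : Fin n → ℤˣ, (if hammingDist z 1 ≤ r then (1 : ℝ) else 0) = ballBinom n r := by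
  simp only [ballBinom, Nat.cast_sum, ← sum_hammingDist_eq]
  rw [sum_comm]
  refine sum_congr rfl fun z _ => ?_
  simp

lemma card_hBall (n r : ℕ) : ((hBall n r).card : ℝ) = ballBinom n r := by
  rw [← sum_hammingDist_le, hBall, sum_boole]

lemma eq_zero_of_sum_cube_zero (g : (Fin 0 → ℤˣ) → ℝ) (hg : ∑ x, g x = 0) (x : Fin 0 → ℤˣ) :
    g x = 0 := by
  rwa [Fintype.sum_subsingleton g x] at hg

/-- Spectral bound for the ball kernel on functions of mean zero. -/
lemma radialForm_ball_le {n : ℕ} (r : ℕ) (g : (Fin n → ℤˣ) → ℝ) (hg : ∑ x, g x = 0) :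
    radialForm (fun k => if k ≤ r then 1 else 0) g ≤ (n - 1).choose r * ∑ x, g x ^ 2 := by
  induction n generalizing r with
  | zero =>
    have h0 := eq_zero_of_sum_cube_zero g hg
    simp [radialForm, h0]
  | succ n ih =>
    set u : (Fin n → ℤˣ) → ℝ := fun x => g (Fin.cons 1 x) + g (Fin.cons (-1) x) with hu
    set v : (Fin n → ℤˣ) → ℝ := fun x => g (Fin.cons 1 x) - g (Fin.cons (-1) x) with hv
    have hu0 : ∑ x, u x = 0 := by rw [← hg, sum_cube_succ]
    have hnorm : ∑ x, g x ^ 2 = (∑ x, u x ^ 2 + ∑ x, v x ^ 2) / 2 := by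
      rw [sum_cube_succ, ← sum_add_distrib, sum_div]
      exact sum_congr rfl fun x _ => by simp only [hu, hv]; ring
    have hsphere : (fun k => (if k ≤ r then (1 : ℝ) else 0) - if k + 1 ≤ r then 1 else 0) =
        fun k => if k = r then 1 else 0 := by
      funext k
      split_ifs <;> first | omega | norm_num
    have hV : radialForm (fun k => if k = r then 1 else 0) v ≤ n.choose r * ∑ x, v x ^ 2 := by
      rw [← sum_hammingDist_eq]
      exact radialForm_le _ (fun k => by split_ifs <;> norm_num) v
    have hU : radialForm (fun k => if k ≤ r then 1 else 0) u +
        radialForm (fun k => if k + 1 ≤ r then 1 else 0) u ≤ n.choose r * ∑ x, u x ^ 2 := by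
      have h1 := ih r u hu0
      cases r with
      | zero =>
        have h2 : radialForm (fun k => if k + 1 ≤ 0 then 1 else 0) u = 0 := by simp [radialForm]
        rw [h2]
        simpa using h1
      | succ r =>
        have h2 := ih r u hu0
        simp only [Nat.add_le_add_iff_right]
        cases n with
        | zero =>
          have h0 := eq_zero_of_sum_cube_zero u hu0
          simp [radialForm, h0]
        | succ n =>
          rw [Nat.choose_succ_succ]
          push_cast
          simp only [Nat.add_sub_cancel] at h1 h2
          linarith
    rw [radialForm_succ, hsphere, radialForm_add, hnorm, Nat.add_sub_cancel]
    linarith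

lemma BStab_eq_radialForm (n r : ℕ) (f : (Fin n → ℤˣ) → ℝ) :
    BStab n r f =
      radialForm (fun k => if k ≤ r then 1 else 0) f / (2 ^ n * (ballBinom n r : ℝ)) := by
  rw [BStab, card_hBall]
  simp only [radialForm, hBall, sum_filter, ite_mul, one_mul, zero_mul]

lemma radialForm_add_const {n : ℕ} (w : ℕ → ℝ) (g : (Fin n → ℤˣ) → ℝ) (hg : ∑ x, g x = 0)
    (c : ℝ) :
    radialForm w (fun x => g x + c) =
      radialForm w g + 2 ^ n * c ^ 2 * ∑ z : Fin n → ℤˣ, w (hammingDist z 1) := by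
  rw [radialForm_eq_sum_mul, radialForm_eq_sum_mul, mul_sum, ← sum_add_distrib]
  refine sum_congr rfl fun z _ => ?_
  have h := sum_cube_mul_right g z
  have hcard : (Fintype.card (Fin n → ℤˣ) : ℝ) = 2 ^ n := by simp
  simp only [add_mul, mul_add, sum_add_distrib, ← mul_sum, ← sum_mul, h, hg]
  simp only [sum_const, card_univ, nsmul_eq_mul, hcard]
  ring

lemma ballBinom_succ_add_choose (n r : ℕ) :
    ballBinom (n + 1) r + n.choose r = 2 * ballBinom n r := by
  induction r with
  | zero => simp [ballBinom]
  | succ r ih =>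
    have h (m : ℕ) : ballBinom m (r + 1) = ballBinom m r + m.choose (r + 1) :=
      sum_range_succ _ _
    rw [h, h, Nat.choose_succ_succ']
    omega

lemma ballBinom_pos (n r : ℕ) : 0 < ballBinom n r := by
  rw [ballBinom, sum_range_succ']
  simp

lemma BStab_indic_le {n : ℕ} (r : ℕ) (A : Finset (Fin (n + 1) → ℤˣ)) (hA : A.card = 2 ^ n) :
    BStab (n + 1) r (indic (n + 1) A) ≤
      (ballBinom n r : ℝ) / (2 * (ballBinom (n + 1) r : ℝ)) := by
  set g : (Fin (n + 1) → ℤˣ) → ℝ := fun x => indic (n + 1) A x - 1 / 2 with hgdef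
  have hcard : (Fintype.card (Fin (n + 1) → ℤˣ) : ℝ) = 2 ^ (n + 1) := by simp
  have hg : ∑ x, g x = 0 := by
    simp only [hgdef, indic, sum_sub_distrib, sum_boole, filter_mem_eq_inter, univ_inter, hA,
      sum_const, card_univ, nsmul_eq_mul, hcard]
    push_cast
    ring
  have hsq : ∑ x, g x ^ 2 = 2 ^ (n + 1) / 4 := by
    have h (x) : g x ^ 2 = 1 / 4 := by
      simp only [hgdef, indic]
      split_ifs <;> norm_num
    simp only [h, sum_const, card_univ, nsmul_eq_mul, hcard]
    ring
  have hf : indic (n + 1) A = fun x => g x + 1 / 2 := by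
    funext x
    simp [hgdef]
  have hpos : (0 : ℝ) < ballBinom (n + 1) r := by exact_mod_cast ballBinom_pos _ _
  have hbound := radialForm_ball_le r g hg
  have hbin : (ballBinom (n + 1) r : ℝ) + n.choose r = 2 * ballBinom n r := by
    exact_mod_cast ballBinom_succ_add_choose n r
  rw [BStab_eq_radialForm, hf, radialForm_add_const _ g hg, sum_hammingDist_le,
    div_le_div_iff₀ (by positivity) (by positivity)]
  rw [hsq, Nat.add_sub_cancel] at hbound
  have h : radialForm (fun k => if k ≤ r then 1 else 0) g +
      2 ^ (n + 1) * (1 / 2) ^ 2 * (ballBinom (n + 1) r : ℝ) ≤ 2 ^ n * ballBinom n r := by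
    have e : (ballBinom n r : ℝ) = (ballBinom (n + 1) r + n.choose r) / 2 := by linarith
    rw [e]
    refine (add_le_add_left hbound _).trans (le_of_eq ?_)
    ring
  calc _ ≤ (2 ^ n * (ballBinom n r : ℝ)) * (2 * ballBinom (n + 1) r) := by gcongr
    _ = _ := by ring

/-- The facet `{x | x 0 = 1}`, a subcube with half of the vertices. -/
def facet (n : ℕ) : Finset (Fin (n + 1) → ℤˣ) :=
  univ.filter fun x => x 0 = 1

lemma card_facet (n : ℕ) : (facet n).card = 2 ^ n := by
  rw [facet, card_filter, sum_cube_succ]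
  simp [show (-1 : ℤˣ) ≠ 1 by decide]

lemma BStab_facet (n r : ℕ) :
    BStab (n + 1) r (indic (n + 1) (facet n)) =
      (ballBinom n r : ℝ) / (2 * (ballBinom (n + 1) r : ℝ)) := by
  have hpos : (0 : ℝ) < ballBinom (n + 1) r := by exact_mod_cast ballBinom_pos _ _
  have hne : (-1 : ℤˣ) ≠ 1 := by decide
  have h : radialForm (fun k => if k ≤ r then 1 else 0) (indic (n + 1) (facet n)) =
      2 ^ n * ballBinom n r := by
    simp only [radialForm, sum_cube_succ, cons_mul_cons, hammingDist_cons_one_one,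
      hammingDist_cons_neg_one_one]
    simp only [indic, facet, mem_filter, mem_univ, true_and, Fin.cons_zero, one_mul, mul_one,
      hne, if_true, if_false, mul_zero, zero_mul, add_zero, sum_hammingDist_le, sum_const,
      card_univ, nsmul_eq_mul]
    simp
  rw [BStab_eq_radialForm, h, pow_succ]
  field_simp

/-- for `n ≥ 1` and `1 ≤ r ≤ n`,
`Γ_B^(n)(2^{n−1}, r) = C(n−1,≤r) / (2·C(n,≤r))`. -/
theorem gammaB_half (n r : ℕ) (hn : 1 ≤ n) (hr1 : 1 ≤ r) (hrn : r ≤ n) :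
    GammaB n (2 ^ (n - 1)) r = (ballBinom (n - 1) r : ℝ) / (2 * (ballBinom n r : ℝ)) := by
  obtain ⟨m, rfl⟩ := Nat.exists_eq_add_of_le' hn
  rw [Nat.add_sub_cancel]
  refine IsGreatest.csSup_eq ⟨⟨facet m, card_facet m, (BStab_facet m r).symm⟩, ?_⟩
  rintro _ ⟨A, hA, rfl⟩
  exact BStab_indic_le r A hA
end
end

section
/- For all 0 < α ≤ 1/2 and 0 < β ≤ 1/2, the sequence n ↦ Γ_S^(n)(⌊α·2^n⌋, 2⌊βn/2⌋+1) converges as n → ∞, and its limit equals Γ_IID(α,β). -/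
open Finset

noncomputable section

open Filter Topology

section Krawtchouk

open Polynomial

/-- The normalized Krawtchouk value `K_r(k) / C(n,r)`: the mean of a character of level `k`
over the Hamming sphere of radius `r` in dimension `n`. -/
def kraw (n r k : ℕ) : ℝ :=
  (((1 - X) ^ k * (1 + X) ^ (n - k) : ℝ[X]).coeff r) / n.choose r

/-- `q` dominates `p` coefficientwise in absolute value. -/
def CoeffDom (p q : ℝ[X]) : Prop := ∀ i, |p.coeff i| ≤ q.coeff i

theorem CoeffDom.mul {p q p' q' : ℝ[X]} (h : CoeffDom p q) (h' : CoeffDom p' q') :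
    CoeffDom (p * p') (q * q') := by
  intro i
  rw [coeff_mul, coeff_mul]
  refine (abs_sum_le_sum_abs _ _).trans (sum_le_sum fun x _ => ?_)
  rw [abs_mul]
  exact mul_le_mul (h _) (h' _) (abs_nonneg _) ((abs_nonneg _).trans (h _))

theorem CoeffDom.pow {p q : ℝ[X]} (h : CoeffDom p q) (k : ℕ) : CoeffDom (p ^ k) (q ^ k) := by
  induction k with
  | zero =>
    intro i
    simp only [pow_zero, coeff_one]
    split_ifs <;> simp
  | succ k ih => simpa only [pow_succ] using ih.mul h

theorem coeffDom_one_add_X : CoeffDom (1 + X) (1 + X) := by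
  intro i
  simp only [coeff_add, coeff_one, coeff_X]
  split_ifs <;> norm_num

theorem coeffDom_one_sub_X_sq : CoeffDom (1 - X ^ 2) (1 + X ^ 2) := by
  intro i
  simp only [coeff_add, coeff_sub, coeff_one, coeff_X_pow]
  split_ifs <;> norm_num

theorem coeffDom_one_sub_X_sq_sq : CoeffDom (1 - X ^ 2) ((1 + X) ^ 2) := by
  intro i
  have h : ((1 + X) ^ 2 : ℝ[X]) = 1 + C 2 * X + X ^ 2 := by
    rw [C_ofNat]; ring
  rw [h]
  simp only [coeff_add, coeff_sub, coeff_one, coeff_X_pow, coeff_C_mul, coeff_X]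
  split_ifs <;> norm_num

theorem abs_coeff_kraw_le {n k l : ℕ} (hl : l ≤ k) (hk : 2 * k ≤ n) (r : ℕ) :
    |((1 - X) ^ k * (1 + X) ^ (n - k) : ℝ[X]).coeff r| ≤
      ((1 + X ^ 2) ^ l * (1 + X) ^ (n - 2 * l) : ℝ[X]).coeff r := by
  obtain ⟨a, rfl⟩ := Nat.exists_eq_add_of_le hl
  obtain ⟨b, rfl⟩ := Nat.exists_eq_add_of_le hk
  have h := ((coeffDom_one_sub_X_sq.pow l).mul
    ((coeffDom_one_sub_X_sq_sq.pow a).mul (coeffDom_one_add_X.pow b))) r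
  have e₁ : ((1 - X) ^ (l + a) * (1 + X) ^ (2 * (l + a) + b - (l + a)) : ℝ[X]) =
      (1 - X ^ 2) ^ l * ((1 - X ^ 2) ^ a * (1 + X) ^ b) := by
    rw [show 2 * (l + a) + b - (l + a) = l + a + b by omega,
      show (1 - X ^ 2 : ℝ[X]) = (1 - X) * (1 + X) by ring]
    simp only [mul_pow, pow_add]
    ring
  have e₂ : ((1 + X ^ 2) ^ l * (1 + X) ^ (2 * (l + a) + b - 2 * l) : ℝ[X]) =
      (1 + X ^ 2) ^ l * (((1 + X) ^ 2) ^ a * (1 + X) ^ b) := by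
    rw [show 2 * (l + a) + b - 2 * l = 2 * a + b by omega, pow_add, pow_mul]
  rw [e₁, e₂]
  exact h

theorem coeff_majorant {n l : ℕ} (hl : 2 * l ≤ n) (r : ℕ) :
    ((1 + X ^ 2) ^ l * (1 + X) ^ (n - 2 * l) : ℝ[X]).coeff r / n.choose r =
      (1 / 2) ^ l * ∑ j ∈ range (l + 1), kraw n r (2 * j) * l.choose j := by
  have h : ((1 + X ^ 2) ^ l * (1 + X) ^ (n - 2 * l) : ℝ[X]) = C ((1 / 2) ^ l) *
      ∑ j ∈ range (l + 1), (1 - X) ^ (2 * j) * (1 + X) ^ (n - 2 * j) * C (l.choose j : ℝ) := by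
    have h₁ : (1 + X ^ 2 : ℝ[X]) = C (1 / 2) * ((1 - X) ^ 2 + (1 + X) ^ 2) := by
      have : (C (1 / 2) * 2 : ℝ[X]) = 1 := by
        rw [← C_ofNat, ← C_mul]; norm_num
      linear_combination (-(1 + X ^ 2)) * this
    rw [h₁, mul_pow, add_pow, mul_assoc, sum_mul, C_pow]
    refine congrArg (C (1 / 2 : ℝ) ^ l * ·) (sum_congr rfl fun j hj => ?_)
    rw [mem_range] at hj
    rw [show n - 2 * j = 2 * (l - j) + (n - 2 * l) by omega, pow_add, pow_mul, pow_mul]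
    simp only [map_natCast]
    ring
  rw [h, coeff_C_mul, finsetSum_coeff, mul_div_assoc, sum_div]
  refine congrArg ((1 / 2 : ℝ) ^ l * ·) (sum_congr rfl fun j _ => ?_)
  rw [coeff_mul_C, kraw]
  ring

theorem kraw_symm {n k r : ℕ} (hk : k ≤ n) (hr : Odd r) : kraw n r k = -kraw n r (n - k) := by
  have h (p : ℝ[X]) : (p.comp (-X)).coeff r = -p.coeff r := by
    rw [show (-X : ℝ[X]) = C (-1) * X by simp, comp_C_mul_X_coeff, hr.neg_one_pow]
    ring
  rw [kraw, kraw, ← neg_div, ← h]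
  congr 2
  simp only [mul_comp, pow_comp, sub_comp, add_comp, one_comp, X_comp, Nat.sub_sub_self hk]
  ring

theorem kraw_eq_sum {n r k : ℕ} (hr : k ≤ r) :
    kraw n r k = ∑ j ∈ range (k + 1),
      (-1) ^ j * k.choose j * (((n - k).choose (r - j) : ℝ) / n.choose r) := by
  have h : ((1 - X) ^ k * (1 + X) ^ (n - k) : ℝ[X]) =
      ∑ j ∈ range (k + 1), C ((-1) ^ j * (k.choose j : ℝ)) * (X ^ j * (1 + X) ^ (n - k)) := by
    rw [show (1 - X : ℝ[X]) = -X + 1 by ring, add_pow, sum_mul]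
    refine sum_congr rfl fun j _ => ?_
    simp only [one_pow, neg_pow (X : ℝ[X]), C_mul, C_pow, C_neg, C_1, map_natCast]
    ring
  rw [kraw, h, finsetSum_coeff, sum_div]
  refine sum_congr rfl fun j hj => ?_
  rw [mem_range] at hj
  rw [coeff_C_mul, coeff_X_pow_mul', if_pos (by omega), coeff_one_add_X_pow, mul_div_assoc]

end Krawtchouk

section Asymptotics

variable {β : ℝ} {r : ℕ → ℕ}

theorem eventually_lt_radius (hβ : 0 < β)
    (hr : Tendsto (fun n => (r n : ℝ) / n) atTop (𝓝 β)) (j : ℕ) : ∀ᶠ n in atTop, j < r n := by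
  have h : Tendsto (fun n => (r n : ℝ) / n * n) atTop atTop :=
    hr.pos_mul_atTop hβ tendsto_natCast_atTop_atTop
  filter_upwards [h.eventually_gt_atTop (j : ℝ), eventually_gt_atTop 0] with n hn hn0
  rw [div_mul_cancel₀ _ (by positivity)] at hn
  exact_mod_cast hn

theorem eventually_radius_add_lt (hβ : β < 1)
    (hr : Tendsto (fun n => (r n : ℝ) / n) atTop (𝓝 β)) (j : ℕ) : ∀ᶠ n in atTop, r n + j < n := by
  have h : Tendsto (fun n : ℕ => (1 - (r n : ℝ) / n) * n) atTop atTop :=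
    (hr.const_sub 1).pos_mul_atTop (by linarith) tendsto_natCast_atTop_atTop
  filter_upwards [h.eventually_gt_atTop (j : ℝ), eventually_gt_atTop 0] with n hn hn0
  rw [sub_mul, div_mul_cancel₀ _ (by positivity)] at hn
  have : (r n : ℝ) + j < n := by linarith
  exact_mod_cast this

theorem tendsto_add_div_add (hr : Tendsto (fun n => (r n : ℝ) / n) atTop (𝓝 β))
    (a b c d e f : ℝ) (h : c + d * β ≠ 0) :
    Tendsto (fun n : ℕ => (a * n + b * r n + e) / (c * n + d * r n + f)) atTop
      (𝓝 ((a + b * β) / (c + d * β))) := by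
  have hinv : Tendsto (fun n : ℕ => (n : ℝ)⁻¹) atTop (𝓝 0) := tendsto_inv_atTop_nhds_zero_nat
  have key (a b e : ℝ) :
      Tendsto (fun n : ℕ => a + b * ((r n : ℝ) / n) + e * (n : ℝ)⁻¹) atTop (𝓝 (a + b * β)) := by
    simpa using ((hr.const_mul b).const_add a).add (hinv.const_mul e)
  refine ((key a b e).div (key c d f) h).congr' ?_
  filter_upwards [eventually_gt_atTop 0] with n hn
  have hn' : (n : ℝ) ≠ 0 := by positivity
  rw [Pi.div_apply, ← mul_div_mul_right _ _ hn']
  congr 1 <;> field_simp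

theorem tendsto_choose_div (hβ0 : 0 < β) (hβ1 : β < 1)
    (hr : Tendsto (fun n => (r n : ℝ) / n) atTop (𝓝 β)) (i j : ℕ) :
    Tendsto (fun n => ((n - i).choose (r n - j) : ℝ) / n.choose (r n)) atTop
      (𝓝 ((1 - β) ^ i * (β / (1 - β)) ^ j)) := by
  have hβ : 1 + -1 * β ≠ 0 := by linarith
  induction j with
  | zero =>
    induction i with
    | zero =>
      simp only [Nat.sub_zero, pow_zero, mul_one]
      refine tendsto_const_nhds.congr' ?_
      filter_upwards [eventually_radius_add_lt hβ1 hr 0] with n hn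
      have : 0 < n.choose (r n) := Nat.choose_pos (by omega)
      rw [div_self (by positivity)]
    | succ i ih =>
      have h := ih.mul (tendsto_add_div_add hr 1 (-1) 1 0 (-i) (-i) (by norm_num))
      have e : (1 - β) ^ (i + 1) * (β / (1 - β)) ^ 0 =
        (1 - β) ^ i * (β / (1 - β)) ^ 0 * ((1 + -1 * β) / (1 + 0 * β)) := by ring
      rw [e]
      refine h.congr' ?_
      filter_upwards [eventually_radius_add_lt hβ1 hr (i + 1)] with n hn
      have hc := Nat.choose_mul_succ_eq (n - (i + 1)) (r n)
      rw [show n - (i + 1) + 1 = n - i by omega] at hc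
      have hc' : ((n - i).choose (r n) : ℝ) * (n - r n - i) =
          (n - (i + 1)).choose (r n) * (n - i) := by
        have := congrArg (Nat.cast (R := ℝ)) hc
        rw [Nat.cast_mul, Nat.cast_mul, Nat.cast_sub (by omega), Nat.cast_sub (by omega),
          Nat.cast_sub (by omega)] at this
        rw [this]
        ring
      have hpos : (n - i : ℝ) ≠ 0 := by
        have : (r n + (i + 1) : ℝ) < n := by exact_mod_cast hn
        have : (0 : ℝ) ≤ r n := by positivity
        linarith
      rw [show (1 * n + -1 * r n + -i : ℝ) = n - r n - i by ring,
        show (1 * n + 0 * r n + -i : ℝ) = n - i by ring, div_mul_div_comm, Nat.sub_zero, hc',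
        mul_div_mul_right _ _ hpos]
  | succ j ih =>
    have h := ih.mul (tendsto_add_div_add hr 0 1 1 (-1) (-j) (j + 1 - i) hβ)
    have e : (1 - β) ^ i * (β / (1 - β)) ^ (j + 1) =
        (1 - β) ^ i * (β / (1 - β)) ^ j * ((0 + 1 * β) / (1 + -1 * β)) := by ring
    rw [e]
    refine h.congr' ?_
    filter_upwards [eventually_radius_add_lt hβ1 hr i, eventually_lt_radius hβ0 hr j] with n hn hj
    have hc := Nat.choose_succ_right_eq (n - i) (r n - (j + 1))
    rw [show r n - (j + 1) + 1 = r n - j by omega] at hc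
    have hc' : ((n - i).choose (r n - j) : ℝ) * (r n - j) =
        (n - i).choose (r n - (j + 1)) * (n - r n + (j + 1 - i)) := by
      have := congrArg (Nat.cast (R := ℝ)) hc
      rw [Nat.cast_mul, Nat.cast_mul, Nat.cast_sub hj.le, Nat.cast_sub (by omega),
        Nat.cast_sub (by omega), Nat.cast_sub (by omega)] at this
      rw [this]
      push_cast
      ring
    have hpos : (n - r n + (j + 1 - i) : ℝ) ≠ 0 := by
      have : (r n + i : ℝ) < n := by exact_mod_cast hn
      have : (0 : ℝ) ≤ j := by positivity
      linarith
    rw [show (1 * n + -1 * r n + (j + 1 - i) : ℝ) = n - r n + (j + 1 - i) by ring,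
      show (0 * n + 1 * r n + -j : ℝ) = r n - j by ring, div_mul_div_comm, hc',
      mul_div_mul_right _ _ hpos]

theorem tendsto_kraw (hβ0 : 0 < β) (hβ1 : β < 1)
    (hr : Tendsto (fun n => (r n : ℝ) / n) atTop (𝓝 β)) (k : ℕ) :
    Tendsto (fun n => kraw n (r n) k) atTop (𝓝 ((1 - 2 * β) ^ k)) := by
  have h : Tendsto (fun n => ∑ j ∈ range (k + 1), (-1) ^ j * k.choose j *
      (((n - k).choose (r n - j) : ℝ) / n.choose (r n))) atTop
      (𝓝 (∑ j ∈ range (k + 1), (-1) ^ j * k.choose j * ((1 - β) ^ k * (β / (1 - β)) ^ j))) :=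
    tendsto_finsetSum _ fun j _ => (tendsto_choose_div hβ0 hβ1 hr k j).const_mul _
  have e : ∑ j ∈ range (k + 1), (-1) ^ j * k.choose j * ((1 - β) ^ k * (β / (1 - β)) ^ j) =
      (1 - 2 * β) ^ k := by
    have hβ : 1 - β ≠ 0 := by linarith
    rw [show 1 - 2 * β = -β + (1 - β) by ring, add_pow]
    refine sum_congr rfl fun j hj => ?_
    rw [mem_range] at hj
    obtain ⟨m, rfl⟩ := Nat.exists_eq_add_of_le (Nat.lt_succ_iff.1 hj)
    rw [Nat.add_sub_cancel_left, div_pow, pow_add, neg_pow β]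
    field_simp
  rw [e] at h
  refine h.congr' ?_
  filter_upwards [eventually_lt_radius hβ0 hr k] with n hn
  rw [kraw_eq_sum hn.le]

/-- For odd radii, the normalized Krawtchouk values are asymptotically bounded above by the
eigenvalues `(1 - 2β)^k` of the i.i.d. noise operator, uniformly in the level `k`. -/
theorem eventually_kraw_le (hβ0 : 0 < β) (hβ1 : β ≤ 1 / 2)
    (hr : Tendsto (fun n => (r n : ℝ) / n) atTop (𝓝 β)) (hodd : ∀ n, Odd (r n))
    {ε : ℝ} (hε : 0 < ε) :
    ∀ᶠ n in atTop, ∀ k ≤ n, kraw n (r n) k ≤ (1 - 2 * β) ^ k + ε := by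
  have hlim := tendsto_kraw hβ0 (by linarith) hr
  have hq : (1 / 2 * ((1 - 2 * β) ^ 2 + 1)) < 1 := by nlinarith
  obtain ⟨l, hl⟩ := exists_pow_lt_of_lt_one hε hq
  have hmaj : Tendsto (fun n => (1 / 2) ^ l *
      ∑ j ∈ range (l + 1), kraw n (r n) (2 * j) * l.choose j) atTop
      (𝓝 ((1 / 2 * ((1 - 2 * β) ^ 2 + 1)) ^ l)) := by
    rw [mul_pow, add_pow]
    refine (tendsto_finsetSum _ fun j _ => ?_).const_mul _
    simpa [pow_mul] using (hlim (2 * j)).mul_const (l.choose j : ℝ)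
  have hsmall : ∀ᶠ n in atTop, ∀ k ∈ range l, |kraw n (r n) k - (1 - 2 * β) ^ k| < ε := by
    rw [Filter.eventually_all_finset]
    intro k _
    simpa [Real.dist_eq] using Metric.tendsto_nhds.1 (hlim k) ε hε
  filter_upwards [hsmall, hmaj.eventually_lt_const hl, eventually_ge_atTop (2 * l)]
    with n hn₁ hn₂ hn₃
  have hpow (k : ℕ) : 0 ≤ (1 - 2 * β) ^ k := pow_nonneg (by linarith) k
  have hlow : ∀ k, 2 * k ≤ n → -ε ≤ kraw n (r n) k ∧ kraw n (r n) k ≤ (1 - 2 * β) ^ k + ε := by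
    intro k hk
    have := hpow k
    rcases lt_or_ge k l with hkl | hkl
    · have := abs_lt.1 (hn₁ k (mem_range.2 hkl))
      constructor <;> linarith
    · rw [← coeff_majorant hn₃] at hn₂
      have habs : |kraw n (r n) k| < ε := by
        refine lt_of_le_of_lt ?_ hn₂
        rw [kraw, abs_div, Nat.abs_cast]
        exact div_le_div_of_nonneg_right (abs_coeff_kraw_le hkl hk _) (Nat.cast_nonneg _)
      have := abs_lt.1 habs
      constructor <;> linarith
  intro k hk
  rcases le_or_gt (2 * k) n with h | h
  · exact (hlow k h).2
  · rw [kraw_symm hk (hodd n)]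
    have := (hlow (n - k) (by omega)).1
    have := hpow k
    linarith

end Asymptotics

section Fourier

variable {n : ℕ}

/-- The character `x ↦ ∏_{i ∈ S} x_i` of the cube. -/
def cubeChar (S : Finset (Fin n)) (x : Fin n → ℤˣ) : ℝ := ∏ i ∈ S, ((x i : ℤ) : ℝ)

/-- The Fourier weight `f̂(S)²`. -/
def fourierWeight (f : (Fin n → ℤˣ) → ℝ) (S : Finset (Fin n)) : ℝ :=
  ((∑ x, f x * cubeChar S x) / 2 ^ n) ^ 2

theorem fourierWeight_nonneg (f : (Fin n → ℤˣ) → ℝ) (S : Finset (Fin n)) :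
    0 ≤ fourierWeight f S := sq_nonneg _

theorem cubeChar_mul (S : Finset (Fin n)) (x y : Fin n → ℤˣ) :
    cubeChar S (x * y) = cubeChar S x * cubeChar S y := by
  simp [cubeChar, prod_mul_distrib]

theorem cubeChar_one (S : Finset (Fin n)) : cubeChar S 1 = 1 := by
  simp [cubeChar]

theorem cubeChar_eq_prod_ite (S : Finset (Fin n)) (x : Fin n → ℤˣ) :
    cubeChar S x = ∏ i, if i ∈ S then ((x i : ℤ) : ℝ) else 1 := by
  simp [cubeChar, prod_ite_mem]

theorem sum_cubeChar (x : Fin n → ℤˣ) :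
    ∑ S : Finset (Fin n), cubeChar S x = if x = 1 then 2 ^ n else 0 := by
  have h : ∑ S : Finset (Fin n), cubeChar S x = ∏ i, (1 + ((x i : ℤ) : ℝ)) := by
    rw [prod_one_add, powerset_univ]
    rfl
  rw [h]
  split_ifs with hx
  · simp [hx, one_add_one_eq_two]
  · obtain ⟨i, hi⟩ := Function.ne_iff.1 hx
    refine prod_eq_zero (mem_univ i) ?_
    rcases Int.units_eq_one_or (x i) with h | h
    · exact absurd h hi
    · simp [h]

theorem cube_mul_eq_one_iff (x y : Fin n → ℤˣ) : x * y = 1 ↔ y = x := by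
  have h : x * x = 1 := funext fun i => Int.units_mul_self (x i)
  constructor
  · intro hxy
    rw [← one_mul y, ← h, mul_assoc, hxy, mul_one]
  · rintro rfl
    exact h

/-- Wiener–Khinchin on the cube. -/
theorem autocorrelation_eq (f : (Fin n → ℤˣ) → ℝ) (z : Fin n → ℤˣ) :
    (∑ x, f x * f (x * z)) / 2 ^ n = ∑ S, fourierWeight f S * cubeChar S z := by
  have h : ∑ S, (∑ x, f x * cubeChar S x) ^ 2 * cubeChar S z =
      2 ^ n * ∑ x, f x * f (x * z) := by
    calc ∑ S, (∑ x, f x * cubeChar S x) ^ 2 * cubeChar S z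
        = ∑ S, ∑ x, ∑ y, f x * f y * cubeChar S (x * z * y) := by
          refine sum_congr rfl fun S _ => ?_
          rw [sq, sum_mul_sum, sum_mul]
          refine sum_congr rfl fun x _ => ?_
          rw [sum_mul]
          refine sum_congr rfl fun y _ => ?_
          rw [cubeChar_mul, cubeChar_mul]
          ring
      _ = ∑ x, ∑ y, f x * f y * ∑ S, cubeChar S (x * z * y) := by
          rw [sum_comm]
          refine sum_congr rfl fun x _ => ?_
          rw [sum_comm]
          simp only [mul_sum]
      _ = 2 ^ n * ∑ x, f x * f (x * z) := by
          rw [mul_sum]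
          refine sum_congr rfl fun x _ => ?_
          simp only [sum_cubeChar, cube_mul_eq_one_iff, mul_ite, mul_zero, sum_ite_eq',
            mem_univ, if_true]
          ring
  simp only [fourierWeight, div_pow, div_mul_eq_mul_div]
  rw [← sum_div, h]
  field_simp

theorem sum_fourierWeight (f : (Fin n → ℤˣ) → ℝ) :
    ∑ S, fourierWeight f S = (∑ x, f x ^ 2) / 2 ^ n := by
  have h := autocorrelation_eq f 1
  simp only [mul_one, cubeChar_one] at h
  rw [← h]
  simp only [sq]

theorem sum_fourierWeight_indic_le_one (A : Finset (Fin n → ℤˣ)) :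
    ∑ S, fourierWeight (indic n A) S ≤ 1 := by
  rw [sum_fourierWeight, div_le_one (by positivity)]
  calc ∑ x, indic n A x ^ 2 ≤ ∑ _x : Fin n → ℤˣ, (1 : ℝ) := by
        refine sum_le_sum fun x _ => ?_
        unfold indic
        split_ifs <;> norm_num
    _ = 2 ^ n := by simp

theorem sum_cube_prod {R : Type*} [CommSemiring R] (g : Fin n → ℤˣ → R) :
    ∑ z : Fin n → ℤˣ, ∏ i, g i (z i) = ∏ i, (g i 1 + g i (-1)) := by
  have h (i : Fin n) : g i 1 + g i (-1) = ∑ u, g i u := by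
    rw [show (univ : Finset ℤˣ) = {1, -1} from rfl, sum_pair (by decide)]
  simp only [h, prod_univ_sum, Fintype.piFinset_univ]

theorem prod_ite_mem_eq_pow {R : Type*} [CommSemiring R] (S : Finset (Fin n)) (a b : R) :
    (∏ i, if i ∈ S then a else b) = a ^ #S * b ^ (n - #S) := by
  rw [prod_ite, prod_const, prod_const, filter_mem_eq_inter, univ_inter, filter_not,
    filter_mem_eq_inter, univ_inter, ← compl_eq_univ_sdiff, card_compl, Fintype.card_fin]

theorem sum_noise_cubeChar (β : ℝ) (S : Finset (Fin n)) :
    ∑ z : Fin n → ℤˣ, (∏ i, if z i = 1 then 1 - β else β) * cubeChar S z =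
      (1 - 2 * β) ^ #S := by
  simp only [cubeChar_eq_prod_ite, ← prod_mul_distrib]
  rw [sum_cube_prod fun i u => (if u = 1 then 1 - β else β) * if i ∈ S then ((u : ℤ) : ℝ) else 1]
  have h := prod_ite_mem_eq_pow S (1 - 2 * β) 1
  rw [one_pow, mul_one] at h
  rw [← h]
  refine prod_congr rfl fun i _ => ?_
  simp only [show (-1 : ℤˣ) ≠ 1 by decide, if_true, if_false]
  split_ifs
  · push_cast
    ring
  · ring

open Polynomial in
theorem sum_hSphere_cubeChar (r : ℕ) (S : Finset (Fin n)) :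
    ∑ z ∈ hSphere n r, cubeChar S z =
      ((1 - X) ^ #S * (1 + X) ^ (n - #S) : ℝ[X]).coeff r := by
  have h : ∑ z : Fin n → ℤˣ, Polynomial.C (cubeChar S z) * X ^ hammingDist z 1 =
      ((1 - X) ^ #S * (1 + X) ^ (n - #S) : ℝ[X]) := by
    have hz (z : Fin n → ℤˣ) : Polynomial.C (cubeChar S z) * X ^ hammingDist z 1 =
        ∏ i, (if i ∈ S then Polynomial.C ((z i : ℤ) : ℝ) else 1) * if z i ≠ 1 then X else 1 := by
      rw [prod_mul_distrib, prod_ite_mem, univ_inter, ← map_prod, hammingDist, ← prod_const,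
        prod_filter]
      rfl
    simp only [hz]
    rw [sum_cube_prod fun i u =>
      (if i ∈ S then Polynomial.C ((u : ℤ) : ℝ) else 1) * if u ≠ 1 then X else 1,
      ← prod_ite_mem_eq_pow]
    refine prod_congr rfl fun i _ => ?_
    simp only [show (-1 : ℤˣ) ≠ 1 by decide, ne_eq, not_true, not_false_iff, if_true, if_false]
    split_ifs
    · simp [sub_eq_add_neg]
    · simp
  rw [← h, finsetSum_coeff, hSphere, sum_filter]
  refine sum_congr rfl fun z _ => ?_
  rw [coeff_C_mul, coeff_X_pow]
  simp only [eq_comm (a := r), mul_ite, mul_one, mul_zero]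

theorem card_hSphere (n r : ℕ) : (#(hSphere n r) : ℝ) = n.choose r := by
  have h := sum_hSphere_cubeChar (n := n) r ∅
  simpa [cubeChar, Polynomial.coeff_one_add_X_pow] using h

theorem sum_hSphere_cubeChar_div (r : ℕ) (S : Finset (Fin n)) :
    (∑ z ∈ hSphere n r, cubeChar S z) / #(hSphere n r) = kraw n r #S := by
  rw [sum_hSphere_cubeChar, card_hSphere, kraw]

theorem SStab_eq_autocorrelation (r : ℕ) (f : (Fin n → ℤˣ) → ℝ) :
    SStab n r f =
      (∑ z ∈ hSphere n r, (∑ x, f x * f (x * z)) / 2 ^ n) / #(hSphere n r) := by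
  rw [SStab, sum_comm, ← sum_div, div_div]

theorem SStab_eq (r : ℕ) (f : (Fin n → ℤˣ) → ℝ) :
    SStab n r f = ∑ S, fourierWeight f S * kraw n r #S := by
  rw [SStab_eq_autocorrelation]
  simp only [autocorrelation_eq, ← sum_hSphere_cubeChar_div]
  rw [sum_comm, sum_div]
  simp only [← mul_sum, mul_div_assoc]

theorem Stab_eq (β : ℝ) (f : (Fin n → ℤˣ) → ℝ) :
    Stab n β f = ∑ S, fourierWeight f S * (1 - 2 * β) ^ #S := by
  rw [Stab, sum_comm]
  simp only [← mul_sum]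
  rw [sum_div]
  simp only [mul_div_assoc, autocorrelation_eq]
  simp only [← sum_noise_cubeChar, mul_sum]
  rw [sum_comm]
  refine sum_congr rfl fun S _ => sum_congr rfl fun z _ => ?_
  ring

end Fourier

section Gamma

theorem Stab_indic_le_one {n : ℕ} {β : ℝ} (hβ0 : 0 ≤ β) (hβ1 : β ≤ 1 / 2)
    (A : Finset (Fin n → ℤˣ)) : Stab n β (indic n A) ≤ 1 := by
  rw [Stab_eq]
  refine (sum_le_sum fun S _ => ?_).trans (sum_fourierWeight_indic_le_one A)
  exact mul_le_of_le_one_right (fourierWeight_nonneg _ _)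
    (pow_le_one₀ (by linarith) (by linarith))

theorem SStab_indic_mono {n r : ℕ} {A B : Finset (Fin n → ℤˣ)} (h : A ⊆ B) :
    SStab n r (indic n A) ≤ SStab n r (indic n B) := by
  have hle (x) : indic n A x ≤ indic n B x := by
    unfold indic
    split_ifs with h₁ h₂ <;> first | exact absurd (h h₁) h₂ | norm_num
  have hnn (x) (A : Finset (Fin n → ℤˣ)) : 0 ≤ indic n A x := by
    unfold indic
    split_ifs <;> norm_num
  refine div_le_div_of_nonneg_right ?_ (by positivity)
  exact sum_le_sum fun x _ => sum_le_sum fun z _ =>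
    mul_le_mul (hle _) (hle _) (hnn _ _) (hnn _ _)

/-- The cylinder over `A`, obtained by adding `d` free coordinates. -/
def cylinder {m : ℕ} (d : ℕ) (A : Finset (Fin m → ℤˣ)) : Finset (Fin (m + d) → ℤˣ) :=
  univ.filter fun x => (fun i => x (Fin.castAdd d i)) ∈ A

theorem sum_comp_castAdd {m : ℕ} (d : ℕ) (g : (Fin m → ℤˣ) → ℝ) :
    ∑ x : Fin (m + d) → ℤˣ, g (fun i => x (Fin.castAdd d i)) = 2 ^ d * ∑ y, g y := by
  rw [← (Fin.appendEquiv m d).sum_comp, Fintype.sum_prod_type, mul_sum]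
  simp [Fin.appendEquiv]

theorem card_cylinder {m : ℕ} (d : ℕ) (A : Finset (Fin m → ℤˣ)) :
    (#(cylinder d A) : ℝ) = 2 ^ d * #A := by
  have h := sum_comp_castAdd d fun y => if y ∈ A then (1 : ℝ) else 0
  rw [← sum_filter, ← sum_filter] at h
  simpa [cylinder] using h

theorem SStab_cylinder {m : ℕ} (d r : ℕ) (A : Finset (Fin m → ℤˣ)) :
    SStab (m + d) r (indic (m + d) (cylinder d A)) =
      ∑ S, fourierWeight (indic m A) S * kraw (m + d) r #S := by
  have hc (z : Fin (m + d) → ℤˣ) :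
      (∑ x, indic (m + d) (cylinder d A) x * indic (m + d) (cylinder d A) (x * z)) / 2 ^ (m + d) =
        ∑ S, fourierWeight (indic m A) S * cubeChar (S.map (Fin.castAddEmb d)) z := by
    have h := autocorrelation_eq (indic m A) fun i => z (Fin.castAdd d i)
    have hsum := sum_comp_castAdd d fun y =>
      indic m A y * indic m A (y * fun i => z (Fin.castAdd d i))
    have e : ∑ x, indic (m + d) (cylinder d A) x * indic (m + d) (cylinder d A) (x * z) =
        2 ^ d * ∑ y, indic m A y * indic m A (y * fun i => z (Fin.castAdd d i)) := by
      rw [← hsum]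
      refine sum_congr rfl fun x _ => ?_
      simp only [indic, cylinder, mem_filter, mem_univ, true_and]
      rfl
    rw [e, pow_add, mul_comm (2 ^ m), mul_div_mul_left _ _ (by positivity), h]
    refine sum_congr rfl fun S _ => ?_
    simp [cubeChar]
  rw [SStab_eq_autocorrelation]
  simp only [hc]
  rw [sum_comm, sum_div]
  refine sum_congr rfl fun S _ => ?_
  rw [← mul_sum, mul_div_assoc, sum_hSphere_cubeChar_div, card_map]

theorem card_cube (n : ℕ) : Fintype.card (Fin n → ℤˣ) = 2 ^ n := by
  simp

theorem floor_mul_two_pow_le {α : ℝ} (hα : α ≤ 1) (n : ℕ) : ⌊α * 2 ^ n⌋₊ ≤ 2 ^ n := by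
  refine Nat.floor_le_of_le ?_
  push_cast
  exact mul_le_of_le_one_left (by positivity) hα

theorem exists_card_eq {n M : ℕ} (h : M ≤ 2 ^ n) : ∃ A : Finset (Fin n → ℤˣ), #A = M := by
  obtain ⟨A, -, hA⟩ := exists_superset_card_eq (s := (∅ : Finset (Fin n → ℤˣ))) (n := M)
    (by simp) (by rwa [card_cube])
  exact ⟨A, hA⟩

theorem SStab_le_GammaS {n M : ℕ} (r : ℕ) {A : Finset (Fin n → ℤˣ)} (hA : #A = M) :
    SStab n r (indic n A) ≤ GammaS n M r := by
  refine le_csSup (Set.Finite.bddAbove ?_) ⟨A, hA, rfl⟩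
  refine (Set.finite_range fun A => SStab n r (indic n A)).subset ?_
  rintro y ⟨B, -, rfl⟩
  exact ⟨B, rfl⟩

theorem Stab_le_GammaIID {n M : ℕ} (β : ℝ) {A : Finset (Fin n → ℤˣ)} (hA : #A = M) :
    Stab n β (indic n A) ≤ GammaIID n M β := by
  refine le_csSup (Set.Finite.bddAbove ?_) ⟨A, hA, rfl⟩
  refine (Set.finite_range fun A => Stab n β (indic n A)).subset ?_
  rintro y ⟨B, -, rfl⟩
  exact ⟨B, rfl⟩

theorem GammaIID_le_GammaIIDlim {α β : ℝ} (hα : α ≤ 1) (hβ0 : 0 ≤ β) (hβ1 : β ≤ 1 / 2) (n : ℕ) :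
    GammaIID n ⌊α * 2 ^ n⌋₊ β ≤ GammaIIDlim α β := by
  refine le_ciSup (f := fun n : ℕ => GammaIID n ⌊α * 2 ^ n⌋₊ β) ⟨1, ?_⟩ n
  rintro _ ⟨m, rfl⟩
  obtain ⟨A, hA⟩ := exists_card_eq (floor_mul_two_pow_le hα m)
  refine csSup_le ⟨_, A, hA, rfl⟩ ?_
  rintro _ ⟨B, -, rfl⟩
  exact Stab_indic_le_one hβ0 hβ1 B

theorem eventually_GammaS_le {α β : ℝ} {r : ℕ → ℕ} (hα : α ≤ 1) (hβ0 : 0 < β) (hβ1 : β ≤ 1 / 2)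
    (hr : Tendsto (fun n => (r n : ℝ) / n) atTop (𝓝 β)) (hodd : ∀ n, Odd (r n))
    {ε : ℝ} (hε : 0 < ε) :
    ∀ᶠ n in atTop, GammaS n ⌊α * 2 ^ n⌋₊ (r n) ≤ GammaIIDlim α β + ε := by
  filter_upwards [eventually_kraw_le hβ0 hβ1 hr hodd hε] with n hn
  obtain ⟨A, hA⟩ := exists_card_eq (floor_mul_two_pow_le hα n)
  refine csSup_le ⟨_, A, hA, rfl⟩ ?_
  rintro _ ⟨B, hB, rfl⟩
  have hle : SStab n (r n) (indic n B) ≤ Stab n β (indic n B) + ε := by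
    rw [SStab_eq, Stab_eq]
    calc ∑ S, fourierWeight (indic n B) S * kraw n (r n) #S
        ≤ ∑ S, fourierWeight (indic n B) S * ((1 - 2 * β) ^ #S + ε) :=
          sum_le_sum fun S _ => mul_le_mul_of_nonneg_left
            (hn _ (card_finset_fin_le S)) (fourierWeight_nonneg _ _)
      _ = ∑ S, fourierWeight (indic n B) S * (1 - 2 * β) ^ #S +
            (∑ S, fourierWeight (indic n B) S) * ε := by
          simp only [mul_add, sum_add_distrib, sum_mul]
      _ ≤ _ := by
          gcongr
          exact mul_le_of_le_one_left hε.le (sum_fourierWeight_indic_le_one B)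
  have := Stab_le_GammaIID β hB
  have := GammaIID_le_GammaIIDlim hα hβ0.le hβ1 n
  linarith

theorem eventually_lt_GammaS {α β c : ℝ} {r : ℕ → ℕ} (hα0 : 0 ≤ α) (hα : α ≤ 1) (hβ0 : 0 < β)
    (hβ1 : β < 1) (hr : Tendsto (fun n => (r n : ℝ) / n) atTop (𝓝 β))
    (hc : c < GammaIIDlim α β) :
    ∀ᶠ n in atTop, c < GammaS n ⌊α * 2 ^ n⌋₊ (r n) := by
  obtain ⟨m, hm⟩ := exists_lt_of_lt_ciSup hc
  obtain ⟨B, hB⟩ := exists_card_eq (floor_mul_two_pow_le hα m)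
  obtain ⟨_, ⟨A, hA, rfl⟩, hcA⟩ := exists_lt_of_lt_csSup (by exact ⟨_, B, hB, rfl⟩) hm
  rw [Stab_eq] at hcA
  have hlim : Tendsto (fun n => ∑ S, fourierWeight (indic m A) S * kraw n (r n) #S) atTop
      (𝓝 (∑ S, fourierWeight (indic m A) S * (1 - 2 * β) ^ #S)) :=
    tendsto_finsetSum _ fun S _ => (tendsto_kraw hβ0 hβ1 hr _).const_mul _
  filter_upwards [hlim.eventually_const_lt hcA, eventually_ge_atTop m] with n hn hmn
  obtain ⟨d, rfl⟩ := Nat.exists_eq_add_of_le hmn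
  have hcard : #(cylinder d A) ≤ ⌊α * 2 ^ (m + d)⌋₊ := by
    refine Nat.le_floor ?_
    rw [card_cylinder, hA, pow_add, ← mul_assoc, mul_comm]
    exact mul_le_mul_of_nonneg_right (Nat.floor_le (by positivity)) (by positivity)
  obtain ⟨A', hsub, hA'⟩ := exists_superset_card_eq hcard
    (by rw [card_cube]; exact floor_mul_two_pow_le hα _)
  rw [← SStab_cylinder] at hn
  exact hn.trans_le ((SStab_indic_mono hsub).trans (SStab_le_GammaS _ hA'))

end Gamma

theorem tendsto_odd_radius_div {β : ℝ} (hβ : 0 ≤ β) :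
    Tendsto (fun n : ℕ => ((2 * ⌊β * n / 2⌋₊ + 1 : ℕ) : ℝ) / n) atTop (𝓝 β) := by
  have h := (tendsto_nat_floor_mul_div_atTop (a := β / 2) (by positivity)).comp
    (tendsto_natCast_atTop_atTop (R := ℝ))
  have hinv : Tendsto (fun n : ℕ => (n : ℝ)⁻¹) atTop (𝓝 0) := tendsto_inv_atTop_nhds_zero_nat
  have h₂ := (h.const_mul 2).add hinv
  rw [show 2 * (β / 2) + 0 = β by ring] at h₂
  refine h₂.congr fun n => ?_
  rw [Function.comp_apply, show β / 2 * (n : ℝ) = β * n / 2 by ring]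
  push_cast
  ring

/-- from Theorem 5: for `0 < α ≤ 1/2` and `0 < β ≤ 1/2`,
`Γ_S^(n)(⌊α·2^n⌋, 2⌊βn/2⌋+1)` converges to `Γ_IID(α,β)` as `n → ∞`. -/
theorem gammaS_odd_tendsto (α β : ℝ) (hα1 : 0 < α) (hα2 : α ≤ 1 / 2)
    (hβ1 : 0 < β) (hβ2 : β ≤ 1 / 2) :
    Tendsto (fun n : ℕ => GammaS n ⌊α * 2 ^ n⌋₊ (2 * ⌊β * n / 2⌋₊ + 1)) atTop
      (𝓝 (GammaIIDlim α β)) := by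
  have hr := tendsto_odd_radius_div hβ1.le
  rw [tendsto_order]
  constructor
  · intro c hc
    exact eventually_lt_GammaS hα1.le (by linarith) hβ1 (by linarith) hr hc
  · intro c hc
    filter_upwards [eventually_GammaS_le (α := α) (by linarith) hβ1 hβ2 hr
      (fun n => odd_two_mul_add_one _) (half_pos (sub_pos.2 hc))] with n hn
    linarith
end
end
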